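/- For every positive integer t, the complete graph on 2t + 1 vertices can be decomposed into t pairwise edge-disjoint Hamiltonian paths together with a matching consisting of t edges (so covering 2t vertices), the paths and the matching together partitioning the edge set of the complete graph; and in any such decomposition every vertex covered by the matching is an endpoint of exactly one of the t Hamiltonian paths. -/

import Mathlib

open SimpleGraph Finset Pointwise

/-- A decomposition of the complete graph on `Fin (2t+1)` into `t` Hamiltonian paths
`p i` from `a i` to `b i` together with a matching `M` of `t` edges, the paths and the
matching together partitioning the edge set. -/
def IsHamPathMatchingDecomposition (t : ℕ) (a b : Fin t → Fin (2 * t + 1))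
    (p : ∀ i, (completeGraph (Fin (2 * t + 1))).Walk (a i) (b i))
    (M : Finset (Sym2 (Fin (2 * t + 1)))) : Prop :=
  (∀ i, (p i).IsHamiltonian) ∧
  M.card = t ∧
  (∀ e ∈ M, e ∈ (completeGraph (Fin (2 * t + 1))).edgeSet) ∧
  (∀ e ∈ M, ∀ f ∈ M, e ≠ f → ∀ v, v ∈ e → v ∉ f) ∧
  ∀ e ∈ (completeGraph (Fin (2 * t + 1))).edgeSet,
    ((∃! i, e ∈ (p i).edges) ∧ e ∉ M) ∨ ((∀ i, e ∉ (p i).edges) ∧ e ∈ M)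

/-- The vertex at position `k` of the `i`-th rotated zigzag path on `{0, …, 2t}`: the zigzag
`i, i + 1, i - 1, i + 2, …, i + t` modulo `2t`, closed up through the extra vertex `2t` and cut
open at its middle edge. -/
def zigzag (t i k : ℕ) : ℕ :=
  if k = t then 2 * t
  else if k < t then
    if (k + t) % 2 = 0 then
      if (k + t) / 2 ≤ i then i - (k + t) / 2 else i + 2 * t - (k + t) / 2
    else i + (k + t) / 2 + 1
  else
    if (k - t - 1) % 2 = 0 then
      if (k - t - 1) / 2 ≤ i then i - (k - t - 1) / 2 else i + 2 * t - (k - t - 1) / 2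
    else i + (k - t - 1) / 2 + 1

theorem zigzag_lt {t i k : ℕ} (hi : i < t) (hk : k ≤ 2 * t) : zigzag t i k < 2 * t + 1 := by
  grind [zigzag]

theorem zigzag_injOn {t i : ℕ} (hi : i < t) : Set.InjOn (zigzag t i) {k | k ≤ 2 * t} := by
  intro k hk l hl h
  simp only [Set.mem_ofPred_eq] at hk hl
  unfold zigzag at h
  split_ifs at h <;> omega

theorem zigzag_succ {t i k : ℕ} (hi : i < t) (hk : k < 2 * t) :
    (zigzag t i k = 2 * t ∧ zigzag t i (k + 1) = i) ∨
    (zigzag t i k = i + t ∧ zigzag t i (k + 1) = 2 * t) ∨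
    (zigzag t i k < 2 * t ∧ zigzag t i (k + 1) < 2 * t ∧
      zigzag t i k ≠ zigzag t i (k + 1) + t ∧ zigzag t i (k + 1) ≠ zigzag t i k + t ∧
      ((zigzag t i k + zigzag t i (k + 1)) / 2 = i ∨
        (zigzag t i k + zigzag t i (k + 1)) / 2 = i + t)) := by
  unfold zigzag
  split_ifs <;> omega

theorem zigzag_of_lt {t i k : ℕ} (hk : k < t) :
    zigzag t i k = if (k + t) % 2 = 0 then
      if (k + t) / 2 ≤ i then i - (k + t) / 2 else i + 2 * t - (k + t) / 2
    else i + (k + t) / 2 + 1 := by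
  rw [zigzag, if_neg hk.ne, if_pos hk]

theorem zigzag_add_add_one (t i j : ℕ) :
    zigzag t i (j + t + 1) = if j % 2 = 0 then
      if j / 2 ≤ i then i - j / 2 else i + 2 * t - j / 2
    else i + j / 2 + 1 := by
  rw [zigzag, if_neg (by omega), if_neg (by omega), show j + t + 1 - t - 1 = j by omega]

theorem exists_zigzag_position {t j : ℕ} (i : ℕ) (hj : j + 1 < 2 * t) (hjt : j + 1 ≠ t) :
    ∃ k < 2 * t,
      (zigzag t i k = if j % 2 = 0 then if j / 2 ≤ i then i - j / 2 else i + 2 * t - j / 2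
        else i + j / 2 + 1) ∧
      (zigzag t i (k + 1) = if (j + 1) % 2 = 0 then
        if (j + 1) / 2 ≤ i then i - (j + 1) / 2 else i + 2 * t - (j + 1) / 2
        else i + (j + 1) / 2 + 1) := by
  rcases le_or_gt t j with h | h
  · refine ⟨j - t, by omega, ?_, ?_⟩
    · rw [zigzag_of_lt (by omega), Nat.sub_add_cancel h]
    · rw [zigzag_of_lt (by omega), show j - t + 1 + t = j + 1 by omega]
  · refine ⟨j + t + 1, by omega, zigzag_add_add_one t i j, ?_⟩
    rw [show j + t + 1 + 1 = j + 1 + t + 1 by omega, zigzag_add_add_one]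

theorem exists_zigzag_position_even {t i m : ℕ} (hm : m < t) (hmt : 2 * m + 1 ≠ t) :
    ∃ k < 2 * t, zigzag t i k = (if m ≤ i then i - m else i + 2 * t - m) ∧
      zigzag t i (k + 1) = i + m + 1 := by
  obtain ⟨k, hk, h1, h2⟩ := exists_zigzag_position i (j := 2 * m) (by omega) hmt
  rw [if_pos (by omega), show 2 * m / 2 = m by omega] at h1
  rw [if_neg (by omega), show (2 * m + 1) / 2 = m by omega] at h2
  exact ⟨k, hk, h1, h2⟩

theorem exists_zigzag_position_odd {t i m : ℕ} (hm : m + 1 < t) (hmt : 2 * m + 2 ≠ t) :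
    ∃ k < 2 * t, zigzag t i k = i + m + 1 ∧
      zigzag t i (k + 1) = if m + 1 ≤ i then i - (m + 1) else i + 2 * t - (m + 1) := by
  obtain ⟨k, hk, h1, h2⟩ := exists_zigzag_position i (j := 2 * m + 1) (by omega) hmt
  rw [if_neg (by omega), show (2 * m + 1) / 2 = m by omega] at h1
  rw [if_pos (by omega), show (2 * m + 1 + 1) / 2 = m + 1 by omega] at h2
  exact ⟨k, hk, h1, h2⟩

theorem exists_zigzag_edge_of_lt {t x y : ℕ} (hxy : x < y) (hy : y < 2 * t) (hne : y ≠ x + t) :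
    ∃ i < t, ∃ k < 2 * t, zigzag t i k = x ∧ zigzag t i (k + 1) = y ∨
      zigzag t i k = y ∧ zigzag t i (k + 1) = x := by
  obtain ⟨i, hi, hs⟩ : ∃ i < t, (x + y) / 2 = i ∨ (x + y) / 2 = i + t := by
    by_cases h : (x + y) / 2 < t
    · exact ⟨(x + y) / 2, h, Or.inl rfl⟩
    · exact ⟨(x + y) / 2 - t, by omega, by omega⟩
  refine ⟨i, hi, ?_⟩
  rcases Nat.mod_two_eq_zero_or_one (x + y) with hpar | hpar <;>
    by_cases h : i < y ∧ y - i - 1 < t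
  · obtain ⟨k, hk, h1, h2⟩ := exists_zigzag_position_odd (t := t) (i := i) (m := y - i - 1)
      (by omega) (by omega)
    refine ⟨k, hk, Or.inr ?_⟩
    split_ifs at h2 <;> omega
  · obtain ⟨k, hk, h1, h2⟩ := exists_zigzag_position_odd (t := t) (i := i) (m := x - i - 1)
      (by omega) (by omega)
    refine ⟨k, hk, Or.inl ?_⟩
    split_ifs at h2 <;> omega
  · obtain ⟨k, hk, h1, h2⟩ := exists_zigzag_position_even (t := t) (i := i) (m := y - i - 1)
      (by omega) (by omega)
    refine ⟨k, hk, Or.inl ?_⟩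
    split_ifs at h1 <;> omega
  · obtain ⟨k, hk, h1, h2⟩ := exists_zigzag_position_even (t := t) (i := i) (m := x - i - 1)
      (by omega) (by omega)
    refine ⟨k, hk, Or.inr ?_⟩
    split_ifs at h1 <;> omega

theorem exists_zigzag_edge {t x y : ℕ} (hxy : x < y) (hy : y ≤ 2 * t)
    (hne : y = 2 * t ∨ y ≠ x + t) :
    ∃ i < t, ∃ k < 2 * t, zigzag t i k = x ∧ zigzag t i (k + 1) = y ∨
      zigzag t i k = y ∧ zigzag t i (k + 1) = x := by
  rcases hy.eq_or_lt with rfl | hy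
  · rcases lt_or_ge x t with hx | hx
    · refine ⟨x, hx, t, by omega, Or.inr ?_⟩
      unfold zigzag
      split_ifs <;> omega
    · refine ⟨x - t, by omega, t - 1, by omega, Or.inl ?_⟩
      unfold zigzag
      split_ifs <;> omega
  · exact exists_zigzag_edge_of_lt hxy hy (hne.resolve_left hy.ne)

theorem SimpleGraph.exists_walk_of_adj {V : Type*} {G : SimpleGraph V} (f : ℕ → V) (n : ℕ)
    (hf : ∀ k < n, G.Adj (f k) (f (k + 1))) :
    ∃ p : G.Walk (f 0) (f n), p.support = (List.range (n + 1)).map f ∧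
      p.edges = (List.range n).map fun k ↦ s(f k, f (k + 1)) := by
  induction n with
  | zero => exact ⟨.nil, by simp⟩
  | succ n ih =>
    obtain ⟨p, hs, he⟩ := ih fun k hk ↦ hf k (by omega)
    refine ⟨p.concat (hf n n.lt_succ_self), ?_, ?_⟩
    · rw [Walk.support_concat, hs, List.range_succ (n := n + 1)]
      simp
    · rw [Walk.edges_concat, he, List.range_succ (n := n)]
      simp

/-- The zigzag paths as sequences in `Fin (2 * t + 1)`, constant after position `2 * t`. -/
def zigzagFin (t : ℕ) (i : Fin t) (k : ℕ) : Fin (2 * t + 1) :=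
  ⟨zigzag t i (min k (2 * t)), zigzag_lt i.2 (min_le_right _ _)⟩

theorem val_zigzagFin {t k : ℕ} (i : Fin t) (hk : k ≤ 2 * t) :
    (zigzagFin t i k : ℕ) = zigzag t i k := by
  simp [zigzagFin, hk]

theorem zigzagFin_injOn {t : ℕ} (i : Fin t) : Set.InjOn (zigzagFin t i) {k | k ≤ 2 * t} := by
  intro k hk l hl h
  rw [Fin.ext_iff, val_zigzagFin i hk, val_zigzagFin i hl] at h
  exact zigzag_injOn i.2 hk hl h

theorem exists_zigzag_walk {t : ℕ} (i : Fin t) :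
    ∃ p : (completeGraph (Fin (2 * t + 1))).Walk (zigzagFin t i 0) (zigzagFin t i (2 * t)),
      p.IsHamiltonian ∧ ∀ e, e ∈ p.edges ↔
        ∃ k < 2 * t, s(zigzagFin t i k, zigzagFin t i (k + 1)) = e := by
  obtain ⟨p, hs, he⟩ := exists_walk_of_adj (G := completeGraph (Fin (2 * t + 1)))
    (zigzagFin t i) (2 * t) fun k hk ↦ by
      rw [completeGraph_eq_top, top_adj]
      intro h
      have := zigzagFin_injOn i (Set.mem_ofPred.2 hk.le) (Set.mem_ofPred.2 hk) h
      omega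
  have hp : p.IsPath := by
    rw [Walk.isPath_def, hs]
    refine List.Nodup.map_on (fun k hk l hl h ↦ ?_) List.nodup_range
    rw [List.mem_range] at hk hl
    exact zigzagFin_injOn i (Nat.le_of_lt_succ hk) (Nat.le_of_lt_succ hl) h
  refine ⟨p, Walk.isHamiltonian_iff_isPath_and_length_eq.2 ⟨hp, ?_⟩, fun e ↦ by simp [he]⟩
  rw [← p.length_edges, he]
  simp

/-- The matching `{x, x + t}`, `x < t`, left over by the zigzag paths. -/
def zigzagMatching (t : ℕ) : Finset (Sym2 (Fin (2 * t + 1))) :=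
  Finset.univ.image fun x : Fin t ↦ s(⟨x, by omega⟩, ⟨x + t, by omega⟩)

theorem mem_zigzagMatching {t : ℕ} {x y : Fin (2 * t + 1)} (hxy : x < y) :
    s(x, y) ∈ zigzagMatching t ↔ (x : ℕ) < t ∧ (y : ℕ) = x + t := by
  rw [Fin.lt_def] at hxy
  simp only [zigzagMatching, Finset.mem_image, Finset.mem_univ, true_and, Sym2.eq_iff, Fin.ext_iff]
  constructor
  · rintro ⟨z, h | h⟩ <;> omega
  · exact fun h ↦ ⟨⟨x, h.1⟩, by simp [h.2]⟩

theorem card_zigzagMatching (t : ℕ) : (zigzagMatching t).card = t := by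
  rw [zigzagMatching, Finset.card_image_of_injective, Finset.card_univ, Fintype.card_fin]
  intro x y h
  simp only [Sym2.eq_iff, Fin.ext_iff] at h
  omega

theorem zigzag_edge_unique {t : ℕ} {i j k l : ℕ} (hi : i < t) (hj : j < t)
    (hk : k < 2 * t) (hl : l < 2 * t)
    (h : zigzag t i k = zigzag t j l ∧ zigzag t i (k + 1) = zigzag t j (l + 1) ∨
      zigzag t i k = zigzag t j (l + 1) ∧ zigzag t i (k + 1) = zigzag t j l) : i = j := by
  have := zigzag_succ hi hk
  have := zigzag_succ hj hl
  omega

theorem exists_isHamPathMatchingDecomposition (t : ℕ) :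
    ∃ a b p M, IsHamPathMatchingDecomposition t a b p M := by
  choose p hp he using fun i : Fin t ↦ exists_zigzag_walk i
  refine ⟨_, _, p, zigzagMatching t, hp, card_zigzagMatching t, ?_, ?_, ?_⟩
  · intro e h
    simp only [zigzagMatching, Finset.mem_image, Finset.mem_univ, true_and] at h
    obtain ⟨x, rfl⟩ := h
    rw [mem_edgeSet, completeGraph_eq_top, top_adj, Ne, Fin.ext_iff]
    simp only
    omega
  · intro e h f h' hne v hv hv'
    simp only [zigzagMatching, Finset.mem_image, Finset.mem_univ, true_and] at h h'
    obtain ⟨x, rfl⟩ := h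
    obtain ⟨y, rfl⟩ := h'
    refine hne ?_
    simp only [Sym2.mem_iff, Fin.ext_iff] at hv hv'
    have : x = y := by omega
    rw [this]
  · intro e
    induction e using Sym2.inductionOn with | _ x y
    intro hxy
    rw [mem_edgeSet, completeGraph_eq_top, top_adj] at hxy
    wlog hlt : x < y generalizing x y
    · rw [Sym2.eq_swap]
      exact this y x hxy.symm (lt_of_le_of_ne (not_lt.1 hlt) hxy.symm)
    have hlt' := Fin.lt_def.1 hlt
    have key (i : Fin t) : s(x, y) ∈ (p i).edges ↔ ∃ k < 2 * t,
        zigzag t i k = x ∧ zigzag t i (k + 1) = y ∨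
        zigzag t i k = y ∧ zigzag t i (k + 1) = x := by
      rw [he]
      refine exists_congr fun k ↦ and_congr_right fun hk ↦ ?_
      rw [Sym2.eq_iff]
      simp only [Fin.ext_iff]
      rw [val_zigzagFin i hk.le, val_zigzagFin i hk]
    simp only [key, mem_zigzagMatching hlt]
    by_cases hM : (x : ℕ) < t ∧ (y : ℕ) = x + t
    · refine Or.inr ⟨?_, hM⟩
      rintro i ⟨k, hk, h⟩
      have := zigzag_succ i.2 hk
      omega
    · refine Or.inl ⟨?_, hM⟩
      obtain ⟨i, hi, h⟩ := exists_zigzag_edge hlt' (Nat.le_of_lt_succ y.2) (by omega)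
      refine ⟨⟨i, hi⟩, h, ?_⟩
      rintro j ⟨l, hl, hjl⟩
      obtain ⟨k, hk, hik⟩ := h
      exact Fin.ext (zigzag_edge_unique j.2 hi hl hk (by grind))

theorem SimpleGraph.Walk.IsHamiltonian.card_filter_mem_edges {V : Type*} [Fintype V] [DecidableEq V]
    {G : SimpleGraph V} {a b : V} {p : G.Walk a b} (hp : p.IsHamiltonian)
    (hV : 3 ≤ Fintype.card V) (v : V) :
    #{w | s(v, w) ∈ p.edges} + (if v = a ∨ v = b then 1 else 0) = 2 := by
  have hlen := hp.length_eq
  have hnil : ¬ p.Nil := by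
    rw [Walk.not_nil_iff_lt_length]
    omega
  have hcard : #{w | s(v, w) ∈ p.edges} = (p.toSubgraph.neighborSet v).ncard := by
    rw [← Set.ncard_coe_finset]
    congr 1
    ext w
    simp [Walk.adj_toSubgraph_iff_mem_edges]
  rw [hcard]
  split_ifs with h
  · rcases h with rfl | rfl
    · rw [hp.isPath.neighborSet_toSubgraph_startpoint hnil, Set.ncard_singleton]
    · rw [hp.isPath.neighborSet_toSubgraph_endpoint hnil, Set.ncard_singleton]
  · obtain ⟨k, rfl, hk⟩ := Walk.mem_support_iff_exists_getVert.1 (hp.mem_support v)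
    refine hp.isPath.ncard_neighborSet_toSubgraph_internal_eq_two ?_ (lt_of_le_of_ne hk ?_)
    · rintro rfl
      simp at h
    · rintro rfl
      simp at h

theorem IsHamPathMatchingDecomposition.existsUnique_endpoint {t : ℕ} (ht : 0 < t)
    {a b : Fin t → Fin (2 * t + 1)}
    {p : ∀ i, (completeGraph (Fin (2 * t + 1))).Walk (a i) (b i)}
    {M : Finset (Sym2 (Fin (2 * t + 1)))} (h : IsHamPathMatchingDecomposition t a b p M)
    {v : Fin (2 * t + 1)} (hv : ∃ e ∈ M, v ∈ e) : ∃! i, v = a i ∨ v = b i := by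
  obtain ⟨hp, -, hM, hdisj, hpart⟩ := h
  have hdeg : ∑ i, #{w | s(v, w) ∈ (p i).edges} + #{w | s(v, w) ∈ M} = 2 * t := by
    have hone (w) (hw : w ∈ Finset.univ.erase v) :
        #{i | s(v, w) ∈ (p i).edges} + (if s(v, w) ∈ M then 1 else 0) = 1 := by
      rcases hpart s(v, w) (by simpa [eq_comm] using hw) with ⟨hi, hwM⟩ | ⟨hi, hwM⟩
      · simpa [hwM, Finset.card_eq_one_iff_existsUnique] using hi
      · simp [hi, hwM]
    have hsum := Finset.sum_congr rfl hone
    simp only [Finset.sum_add_distrib, Finset.card_filter] at hsum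
    rw [Finset.sum_comm] at hsum
    have hp_loop (i) : s(v, v) ∉ (p i).edges := fun h ↦ (Walk.adj_of_mem_edges _ h).ne rfl
    have hM_loop : s(v, v) ∉ M := fun h ↦ ((mem_edgeSet _).1 (hM _ h)).ne rfl
    simpa [Finset.filter_erase, hp_loop, hM_loop] using hsum
  have hMv : #{w | s(v, w) ∈ M} = 1 := by
    obtain ⟨e, he, w, rfl⟩ := hv
    refine Finset.card_eq_one.2 ⟨w, ?_⟩
    ext u
    simp only [Finset.mem_filter, Finset.mem_univ, true_and, Finset.mem_singleton]
    refine ⟨fun hu ↦ ?_, fun hu ↦ hu ▸ he⟩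
    by_contra hne
    exact hdisj _ hu _ he (fun h ↦ hne (Sym2.congr_right.1 h)) v (by simp) (by simp)
  have hends := Finset.sum_congr (s₁ := Finset.univ) rfl fun i _ ↦
    (hp i).card_filter_mem_edges (by simp; omega) v
  rw [Finset.sum_add_distrib, ← Finset.card_filter] at hends
  simp only [Finset.sum_const, Finset.card_univ, Fintype.card_fin, smul_eq_mul] at hends
  have : #{i | v = a i ∨ v = b i} = 1 := by omega
  simpa [Finset.card_eq_one_iff_existsUnique] using this

/-- For every positive integer `t`, the complete graph on `2t + 1` vertices
can be decomposed into `t` pairwise edge-disjoint Hamiltonian paths together with a matching of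
`t` edges, and in any such decomposition every vertex covered by the matching is an endpoint of
exactly one of the `t` Hamiltonian paths. -/
theorem completeGraph_odd_hamPathDecomposition (t : ℕ) (ht : 0 < t) :
    (∃ a b p M, IsHamPathMatchingDecomposition t a b p M) ∧
    ∀ a b p M, IsHamPathMatchingDecomposition t a b p M →
      ∀ v : Fin (2 * t + 1), (∃ e ∈ M, v ∈ e) → ∃! i, v = a i ∨ v = b i := by
  exact ⟨exists_isHamPathMatchingDecomposition t, fun _ _ _ _ h _ hv ↦ h.existsUnique_endpoint ht hv⟩
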